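/- Let R be a noetherian local ring and R → R^h its henselization. Then R → R^h is a flat local ring homomorphism and the induced map of completions R̂ → (R^h)^∧ is an isomorphism. -/

import Mathlib

/-!
STATEMENT 9: Let R be a noetherian local ring and R → R^h its henselization.  Then
R → R^h is a flat local ring homomorphism and the induced map of completions
R̂ → (R^h)^∧ is an isomorphism.

The henselization is characterized by its universal property: a henselian local
R-algebra which is universal among local homomorphisms from R to henselian local rings.
The isomorphy of the induced map on completions is expressed by the existence of a ring
isomorphism of the two completions compatible with the canonical maps from R.
-/

open IsLocalRing

/-- `S` is a henselization of the local ring `R` if it is a henselian local `R`-algebra,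
the structure map is a local homomorphism, and it is universal among local homomorphisms
from `R` to henselian local rings. -/
structure IsHenselization (R S : Type) [CommRing R] [IsLocalRing R] [CommRing S]
    [IsLocalRing S] [Algebra R S] : Prop where
  isLocalHom : IsLocalHom (algebraMap R S)
  henselian : HenselianLocalRing S
  universal : ∀ (T : Type) [CommRing T] [IsLocalRing T] [HenselianLocalRing T]
    (g : R →+* T), IsLocalHom g →
      ∃! h : S →+* T, IsLocalHom h ∧ h.comp (algebraMap R S) = g

section EtaleElements

open Polynomial TensorProduct

universe u

variable (R S : Type u) [CommRing R] [CommRing S] [Algebra R S]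

/-- The elements of an `R`-algebra `S` that lie in the image of some étale `R`-algebra. -/
def etaleElements : Subalgebra R S where
  carrier := {x | ∃ (A : Type u) (_ : CommRing A) (_ : Algebra R A) (_ : Algebra.Etale R A)
    (φ : A →ₐ[R] S), x ∈ φ.range}
  algebraMap_mem' r := ⟨R, _, _, inferInstance, Algebra.ofId R S, r, rfl⟩
  add_mem' := by
    rintro _ _ ⟨A, _, _, _, φ, a, rfl⟩ ⟨B, _, _, _, ψ, b, rfl⟩
    exact ⟨A ⊗[R] B, _, _, .comp R A _, Algebra.TensorProduct.productMap φ ψ,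
      a ⊗ₜ 1 + 1 ⊗ₜ b, by simp⟩
  mul_mem' := by
    rintro _ _ ⟨A, _, _, _, φ, a, rfl⟩ ⟨B, _, _, _, ψ, b, rfl⟩
    exact ⟨A ⊗[R] B, _, _, .comp R A _, Algebra.TensorProduct.productMap φ ψ,
      a ⊗ₜ b, by simp⟩

variable {R S}

lemma exists_etale_range_of_finite {s : Set S} (hs : s.Finite) (h : s ⊆ etaleElements R S) :
    ∃ (A : Type u) (_ : CommRing A) (_ : Algebra R A) (_ : Algebra.Etale R A)
      (φ : A →ₐ[R] S), s ⊆ φ.range := by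
  induction s, hs using Set.Finite.induction_on with
  | empty => exact ⟨R, _, _, inferInstance, Algebra.ofId R S, Set.empty_subset _⟩
  | @insert x s _ _ ih =>
    rw [Set.insert_subset_iff] at h
    obtain ⟨A, _, _, _, φ, a, rfl⟩ := h.1
    obtain ⟨B, _, _, _, ψ, hψ⟩ := ih h.2
    refine ⟨A ⊗[R] B, _, _, .comp R A _, Algebra.TensorProduct.productMap φ ψ,
      Set.insert_subset ⟨a ⊗ₜ 1, by simp⟩ fun y hy ↦ ?_⟩
    obtain ⟨b, rfl⟩ := hψ hy
    exact ⟨1 ⊗ₜ b, by simp⟩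

lemma isUnit_of_isUnit_coe_etaleElements {x : etaleElements R S} (hx : IsUnit (x : S)) :
    IsUnit x := by
  obtain ⟨A, _, _, _, φ, a, ha⟩ := x.2
  have hu : ∀ y : Submonoid.powers a, IsUnit (φ y) := by
    rintro ⟨_, n, rfl⟩
    have : IsUnit (φ a) := ha ▸ hx
    simpa using this.pow n
  let ψ : Localization.Away a →ₐ[R] S := IsLocalization.liftAlgHom (M := Submonoid.powers a) hu
  have hψ : ψ (algebraMap A _ a) = x := by
    rw [← ha]; exact IsLocalization.lift_eq _ a
  have hinv := IsLocalization.Away.mul_invSelf (S := Localization.Away a) a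
  refine IsUnit.of_mul_eq_one ⟨ψ (IsLocalization.Away.invSelf a),
    ⟨Localization.Away a, _, _, inferInstance, ψ, _, rfl⟩⟩ (Subtype.ext ?_)
  simp [← hψ, ← map_mul, hinv]

instance : IsLocalHom (etaleElements R S).val.toRingHom :=
  ⟨fun _ ↦ isUnit_of_isUnit_coe_etaleElements⟩

instance [IsLocalRing S] : IsLocalRing (etaleElements R S) :=
  RingHom.domain_isLocalRing (etaleElements R S).val.toRingHom

/-- A root in `S` of a monic polynomial over `etaleElements R S`, at which the derivative is a unit,
lies in `etaleElements R S`. -/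
lemma mem_etaleElements_of_isRoot {f : (etaleElements R S)[X]} (hf : f.Monic) {x : S}
    (hx : aeval x f = 0) (hx' : IsUnit (aeval x f.derivative)) : x ∈ etaleElements R S := by
  obtain ⟨A, _, _, _, φ, hφ⟩ := exists_etale_range_of_finite (R := R) (S := S)
    (s := (f.map (etaleElements R S).val.toRingHom).coeffs) (Finset.finite_toSet _) (by
      intro y hy
      obtain ⟨n, -, rfl⟩ := mem_coeffs_iff.1 (Finset.mem_coe.1 hy)
      simp)
  have hmem : f.map (etaleElements R S).val.toRingHom ∈ lifts φ.toRingHom := by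
    rw [lifts_iff_coeff_lifts]
    intro n
    by_cases h0 : (f.map (etaleElements R S).val.toRingHom).coeff n = 0
    · exact ⟨0, by rw [h0, map_zero]⟩
    · exact hφ (Finset.mem_coe.2 (coeff_mem_coeffs h0))
  obtain ⟨F, hF, -, hFm⟩ := lifts_and_natDegree_eq_and_monic hmem (hf.map _)
  let P : StandardEtalePair A := ⟨F, hFm, derivative F, 1, 0, 1, by simp⟩
  let := φ.toRingHom.toAlgebra
  have : IsScalarTower R A S := .of_algebraMap_eq fun r ↦ (φ.commutes r).symm
  have key : ∀ g : (etaleElements R S)[X], aeval x g =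
      (g.map (etaleElements R S).val.toRingHom).eval x := fun g ↦ by
    rw [eval_map]; rfl
  have key' : ∀ G : A[X], aeval x G = (G.map φ.toRingHom).eval x := fun g ↦ by
    rw [eval_map]; rfl
  have hP : P.HasMap x := by
    refine ⟨?_, ?_⟩
    · rw [key', hF, ← key, hx]
    · rw [key', ← derivative_map, hF, derivative_map, ← key]
      exact hx'
  let : Algebra R P.Ring := ((algebraMap A P.Ring).comp (algebraMap R A)).toAlgebra
  have : IsScalarTower R A P.Ring := .of_algebraMap_eq fun r ↦ rfl
  exact ⟨P.Ring, _, _, .comp R A _, (P.lift x hP).restrictScalars R, P.X, by simp⟩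

instance [HenselianLocalRing S] : HenselianLocalRing (etaleElements R S) where
  is_henselian f hf a₀ h₁ h₂ := by
    let ι := (etaleElements R S).val.toRingHom
    have hι (y : etaleElements R S) : (y : S) ∈ maximalIdeal S ↔ y ∈ maximalIdeal _ :=
      map_mem_nonunits_iff ι y
    have heval (g : (etaleElements R S)[X]) : (g.map ι).eval (a₀ : S) = g.eval a₀ :=
      eval_map_apply (f := ι) a₀
    obtain ⟨a, ha, ha'⟩ := HenselianLocalRing.is_henselian (f.map ι) (hf.map ι) (a₀ : S)
      (by rwa [heval, hι])
      (by rw [derivative_map, heval]; exact h₂.map ι)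
    have hunit : IsUnit ((f.derivative.map ι).eval a) := by
      by_contra hn
      have hdvd := sub_dvd_eval_sub a (a₀ : S) (f.derivative.map ι)
      have := Ideal.sub_mem _ ((mem_maximalIdeal _).2 hn) (Ideal.mem_of_dvd _ hdvd ha')
      rw [sub_sub_cancel, heval, hι] at this
      exact this h₂
    have hmem : a ∈ etaleElements R S :=
      mem_etaleElements_of_isRoot hf (by rwa [IsRoot, eval_map] at ha) (by rwa [eval_map] at hunit)
    refine ⟨⟨a, hmem⟩, Subtype.val_injective ?_, (hι _).1 ha'⟩
    exact (eval_map_apply (f := ι) (⟨a, hmem⟩ : etaleElements R S)).symm.trans ha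

end EtaleElements

section Henselization

variable {R S : Type} [CommRing R] [IsLocalRing R] [CommRing S] [IsLocalRing S] [Algebra R S]

lemma IsHenselization.etaleElements_eq_top (h : IsHenselization R S) :
    etaleElements R S = ⊤ := by
  have := h.isLocalHom
  have := h.henselian
  let ι := (etaleElements R S).val.toRingHom
  have hcomp : ι.comp (algebraMap R (etaleElements R S)) = algebraMap R S := rfl
  have hloc : IsLocalHom (ι.comp (algebraMap R (etaleElements R S))) := hcomp ▸ h.isLocalHom
  obtain ⟨g, ⟨_, hg⟩, -⟩ := h.universal (etaleElements R S) (algebraMap R _)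
    (isLocalHom_of_comp _ ι)
  have hid : ι.comp g = RingHom.id S :=
    (h.universal S (algebraMap R S) h.isLocalHom).unique
      ⟨RingHom.isLocalHom_comp _ _, by rw [RingHom.comp_assoc, hg, hcomp]⟩
      ⟨inferInstance, rfl⟩
  refine eq_top_iff.2 fun x _ ↦ ?_
  rw [← RingHom.id_apply x, ← hid]
  exact (g x).2

instance [IsNoetherianRing R] : HenselianLocalRing (AdicCompletion (maximalIdeal R) R) where
  is_henselian f hf a₀ h₁ h₂ :=
    HenselianRing.is_henselian (I := maximalIdeal (AdicCompletion (maximalIdeal R) R))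
      f hf a₀ h₁ (h₂.map _)

lemma IsHenselization.exists_algHom_adicCompletion [IsNoetherianRing R]
    (h : IsHenselization R S) :
    ∃ θ : S →ₐ[R] AdicCompletion (maximalIdeal R) R, IsLocalHom θ := by
  obtain ⟨θ, ⟨hθ, hc⟩, -⟩ := h.universal (AdicCompletion (maximalIdeal R) R)
    (algebraMap R _) inferInstance
  exact ⟨⟨θ, fun r ↦ RingHom.congr_fun hc r⟩, ⟨hθ.1⟩⟩

end Henselization

section Approximation

variable {R S : Type*} [CommRing R] [IsLocalRing R] [CommRing S] [IsLocalRing S] [Algebra R S]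

/-- If `S` has the same residue field as `R` and `𝔪_S = 𝔪_R S`, then `S = R + 𝔪_R ^ n S`. -/
lemma exists_sub_algebraMap_mem_pow
    (hres : ∀ x : S, ∃ r : R, x - algebraMap R S r ∈ maximalIdeal S)
    (hmax : (maximalIdeal R).map (algebraMap R S) = maximalIdeal S) (n : ℕ) (x : S) :
    ∃ r : R, x - algebraMap R S r ∈ ((maximalIdeal R) ^ n).map (algebraMap R S) := by
  induction n generalizing x with
  | zero => exact ⟨0, by simp [Ideal.map_top]⟩
  | succ n ih =>
    suffices H : ∀ y ∈ ((maximalIdeal R) ^ n).map (algebraMap R S), ∃ r : R,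
        y - algebraMap R S r ∈ ((maximalIdeal R) ^ (n + 1)).map (algebraMap R S) by
      obtain ⟨r, hr⟩ := ih x
      obtain ⟨t, ht⟩ := H _ hr
      exact ⟨r + t, by rwa [map_add, ← sub_sub]⟩
    intro y hy
    induction hy using Submodule.closure_induction with
    | zero => exact ⟨0, by simp⟩
    | add y z _ _ hy hz =>
      obtain ⟨r, hr⟩ := hy
      obtain ⟨t, ht⟩ := hz
      exact ⟨r + t, by rw [map_add, add_sub_add_comm]; exact add_mem hr ht⟩
    | smul_mem a y hy =>
      obtain ⟨r, hr, rfl⟩ := hy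
      obtain ⟨t, ht⟩ := hres a
      refine ⟨t * r, ?_⟩
      rw [smul_eq_mul, map_mul, ← sub_mul, pow_succ', Ideal.map_mul, hmax]
      exact Ideal.mul_mem_mul ht (Ideal.mem_map_of_mem _ hr)

lemma AlgHom.eq_zero_of_mem_map {R S : Type*} [CommRing R] [CommRing S] [Algebra R S]
    {I : Ideal R} (π : S →ₐ[R] R ⧸ I) {x : S} (hx : x ∈ I.map (algebraMap R S)) : π x = 0 := by
  suffices I.map (algebraMap R S) ≤ RingHom.ker π from this hx
  rw [Ideal.map_le_iff_le_comap]
  intro r hr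
  simpa [RingHom.mem_ker, Ideal.Quotient.eq_zero_iff_mem] using hr

variable [IsNoetherianRing R]

lemma exists_sub_algebraMap_mem_of_algHom_adicCompletion
    (θ : S →ₐ[R] AdicCompletion (maximalIdeal R) R) [IsLocalHom θ] (x : S) :
    ∃ r : R, x - algebraMap R S r ∈ maximalIdeal S := by
  obtain ⟨t, ht⟩ := (AdicCompletion.residueField_map_bijective R).2 (residue _ (θ x))
  obtain ⟨r, rfl⟩ := residue_surjective t
  refine ⟨r, ?_⟩
  rw [ResidueField.map_residue, ← sub_eq_zero, ← map_sub, residue_eq_zero_iff,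
    ← neg_mem_iff, neg_sub, ← θ.commutes, ← map_sub] at ht
  exact (map_mem_nonunits_iff θ _).1 ht

/-- A noetherian local `R`-algebra with maximal ideal generated by that of `R` embeds in the
completion of `R` as soon as it maps locally to it. -/
lemma injective_algHom_adicCompletion [IsNoetherianRing S]
    (θ : S →ₐ[R] AdicCompletion (maximalIdeal R) R) [IsLocalHom θ]
    (hmax : (maximalIdeal R).map (algebraMap R S) = maximalIdeal S) :
    Function.Injective θ := by
  rw [injective_iff_map_eq_zero]
  intro y hy
  suffices y ∈ ⨅ n : ℕ, maximalIdeal S ^ n by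
    rwa [Ideal.iInf_pow_eq_bot_of_isLocalRing _ Ideal.IsPrime.ne_top'] at this
  rw [Ideal.mem_iInf]
  intro n
  obtain ⟨r, hr⟩ := exists_sub_algebraMap_mem_pow
    (exists_sub_algebraMap_mem_of_algHom_adicCompletion θ) hmax n y
  have h0 := AlgHom.eq_zero_of_mem_map ((AdicCompletion.evalₐ (maximalIdeal R) n).comp θ) hr
  have hrn : r ∈ maximalIdeal R ^ n := by
    rw [map_sub, AlgHom.commutes, AlgHom.comp_apply, hy, map_zero, zero_sub, neg_eq_zero] at h0
    exact Ideal.Quotient.eq_zero_iff_mem.1 h0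
  rw [← hmax, ← Ideal.map_pow]
  simpa using add_mem hr (Ideal.mem_map_of_mem (algebraMap R S) hrn)

end Approximation

namespace AdicCompletion

variable {R S : Type*} [CommRing R] [CommRing S] (I : Ideal R) (J : Ideal S)

lemma factorPow_evalₐ {m n : ℕ} (hle : m ≤ n) (x : AdicCompletion I R) :
    Ideal.Quotient.factorPow I hle (evalₐ I n x) = evalₐ I m x := by
  obtain ⟨x, rfl⟩ := mk_surjective I R x
  simp only [evalₐ_mk, Ideal.Quotient.factor_mk]
  exact (Ideal.mk_eq_mk I hle x)

lemma factorPow_comp_comp_evalₐ {e : ∀ n, R ⧸ I ^ n →+* S ⧸ J ^ n}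
    (he : ∀ {m n : ℕ} (hle : m ≤ n) (x : R ⧸ I ^ n),
      Ideal.Quotient.factorPow J hle (e n x) = e m (Ideal.Quotient.factorPow I hle x))
    {m n : ℕ} (hle : m ≤ n) :
    (Ideal.Quotient.factorPow J hle).comp ((e n).comp (evalₐ I n : AdicCompletion I R →+* _)) =
      (e m).comp (evalₐ I m : AdicCompletion I R →+* _) := by
  ext x
  simp [he, factorPow_evalₐ]

/-- The ring homomorphism of completions induced by compatible homomorphisms `R / Iⁿ → S / Jⁿ`. -/
noncomputable def mapOfQuotients (e : ∀ n, R ⧸ I ^ n →+* S ⧸ J ^ n)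
    (he : ∀ {m n : ℕ} (hle : m ≤ n) (x : R ⧸ I ^ n),
      Ideal.Quotient.factorPow J hle (e n x) = e m (Ideal.Quotient.factorPow I hle x)) :
    AdicCompletion I R →+* AdicCompletion J S :=
  liftRingHom J (fun n ↦ (e n).comp (evalₐ I n : AdicCompletion I R →+* _))
    (factorPow_comp_comp_evalₐ I J he)

lemma evalₐ_mapOfQuotients (e : ∀ n, R ⧸ I ^ n →+* S ⧸ J ^ n)
    (he : ∀ {m n : ℕ} (hle : m ≤ n) (x : R ⧸ I ^ n),
      Ideal.Quotient.factorPow J hle (e n x) = e m (Ideal.Quotient.factorPow I hle x))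
    (n : ℕ) (x : AdicCompletion I R) :
    evalₐ J n (mapOfQuotients I J e he x) = e n (evalₐ I n x) := by
  rw [mapOfQuotients, evalₐ_liftRingHom (hf := factorPow_comp_comp_evalₐ I J he),
    RingHom.comp_apply, RingHom.coe_coe]

/-- If `R → S` induces isomorphisms `R / Iⁿ ≅ S / Jⁿ` for all `n`, then it induces an isomorphism
of completions. -/
lemma exists_ringEquiv_of_bijective_quotientMap [Algebra R S]
    (hIJ : ∀ n, I ^ n ≤ (J ^ n).comap (algebraMap R S))
    (hbij : ∀ n, Function.Bijective (Ideal.quotientMap (J ^ n) (algebraMap R S) (hIJ n))) :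
    ∃ ψ : AdicCompletion I R ≃+* AdicCompletion J S, ∀ r : R,
      ψ (algebraMap R _ r) = algebraMap S _ (algebraMap R S r) := by
  let e (n : ℕ) : R ⧸ I ^ n ≃+* S ⧸ J ^ n := RingEquiv.ofBijective _ (hbij n)
  have hmk (n : ℕ) (r : R) : e n (Ideal.Quotient.mk _ r) = Ideal.Quotient.mk _ (algebraMap R S r) :=
    Ideal.quotientMap_mk (H := hIJ n)
  have he {m n : ℕ} (hle : m ≤ n) (x : R ⧸ I ^ n) :
      Ideal.Quotient.factorPow J hle (e n x) = e m (Ideal.Quotient.factorPow I hle x) := by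
    obtain ⟨r, rfl⟩ := Ideal.Quotient.mk_surjective x
    rw [hmk, Ideal.Quotient.factor_mk, Ideal.Quotient.factor_mk, hmk]
  have he' {m n : ℕ} (hle : m ≤ n) (x : S ⧸ J ^ n) :
      Ideal.Quotient.factorPow I hle ((e n).symm x) =
        (e m).symm (Ideal.Quotient.factorPow J hle x) := by
    rw [RingEquiv.eq_symm_apply, ← he, RingEquiv.apply_symm_apply]
  let ψ := mapOfQuotients I J (fun n ↦ (e n : _ →+* _)) he
  let χ := mapOfQuotients J I (fun n ↦ ((e n).symm : _ →+* _)) he'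
  have hψ (n : ℕ) (x : AdicCompletion I R) : evalₐ J n (ψ x) = e n (evalₐ I n x) :=
    evalₐ_mapOfQuotients ..
  have hχ (n : ℕ) (x : AdicCompletion J S) : evalₐ I n (χ x) = (e n).symm (evalₐ J n x) :=
    evalₐ_mapOfQuotients ..
  refine ⟨RingEquiv.ofRingHom ψ χ (RingHom.ext fun x ↦ ext_evalₐ fun n ↦ ?_)
    (RingHom.ext fun x ↦ ext_evalₐ fun n ↦ ?_), fun r ↦ ext_evalₐ fun n ↦ ?_⟩
  · rw [RingHom.comp_apply, hψ, hχ, RingEquiv.apply_symm_apply, RingHom.id_apply]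
  · rw [RingHom.comp_apply, hχ, hψ, RingEquiv.symm_apply_apply, RingHom.id_apply]
  · rw [RingEquiv.ofRingHom_apply, hψ, AlgHom.commutes, AlgHom.commutes]
    exact hmk n r

end AdicCompletion

section Henselization

variable {R S : Type} [CommRing R] [IsLocalRing R] [CommRing S] [IsLocalRing S] [Algebra R S]
  [IsNoetherianRing R]

/-- Every finite subset of a henselization is contained in the isomorphic image of a localization
of an étale algebra. -/
lemma IsHenselization.exists_injective_algHom (h : IsHenselization R S) {s : Set S}
    (hs : s.Finite) :
    ∃ (B : Type) (_ : CommRing B) (_ : IsLocalRing B) (_ : Algebra R B) (_ : Module.Flat R B)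
      (φ : B →ₐ[R] S), IsLocalHom φ ∧ Function.Injective φ ∧
        (maximalIdeal R).map (algebraMap R B) = maximalIdeal B ∧ s ⊆ φ.range := by
  obtain ⟨θ, hθ⟩ := h.exists_algHom_adicCompletion
  have := h.isLocalHom
  obtain ⟨A, _, _, _, φ, hφ⟩ := exists_etale_range_of_finite (R := R) hs
    (by simp [h.etaleElements_eq_top])
  let p : Ideal A := (maximalIdeal S).comap φ
  have : IsNoetherianRing A := Algebra.FiniteType.isNoetherianRing R A
  have hu : ∀ y : p.primeCompl, IsUnit (φ y) := fun y ↦ by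
    simpa [p, Ideal.primeCompl] using y.2
  let φp : Localization.AtPrime p →ₐ[R] S := IsLocalization.liftAlgHom (M := p.primeCompl) hu
  have hφp (a : A) : φp (algebraMap A _ a) = φ a := IsLocalization.lift_eq _ a
  have hloc : IsLocalHom φp := by
    have : IsLocalHom (φp : Localization.AtPrime p →+* S) := by
      refine ((local_hom_TFAE (φp : Localization.AtPrime p →+* S)).out 2 0).1 ?_
      rw [← Localization.AtPrime.map_eq_maximalIdeal, Ideal.map_map, Ideal.map_le_iff_le_comap]
      intro a ha
      simpa [hφp, p] using ha
    exact ⟨this.1⟩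
  have : IsLocalHom (algebraMap R (Localization.AtPrime p)) := by
    have : IsLocalHom ((φp : Localization.AtPrime p →+* S).comp
        (algebraMap R (Localization.AtPrime p))) := by
      rwa [AlgHom.comp_algebraMap_of_tower]
    exact isLocalHom_of_comp _ (φp : Localization.AtPrime p →+* S)
  have : Algebra.FormallyUnramified R (Localization.AtPrime p) := .comp R A _
  have hmax := Algebra.FormallyUnramified.map_maximalIdeal (R := R) (S := Localization.AtPrime p)
  have : IsLocalHom (θ.comp φp) := ⟨fun _ hb ↦ hloc.1 _ (hθ.1 _ hb)⟩
  have hinj := injective_algHom_adicCompletion (θ.comp φp) hmax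
  refine ⟨Localization.AtPrime p, _, inferInstance, _, .trans R A _, φp, hloc,
    Function.Injective.of_comp (f := θ) hinj, hmax, fun x hx ↦ ?_⟩
  obtain ⟨a, rfl⟩ := hφ hx
  exact ⟨algebraMap A _ a, hφp a⟩

lemma IsHenselization.flat (h : IsHenselization R S) : Module.Flat R S := by
  rw [Module.Flat.iff_forall_isTrivialRelation]
  intro l f x hfx
  obtain ⟨B, _, _, _, _, φ, -, hinj, -, hx⟩ := h.exists_injective_algHom (Set.finite_range x)
  choose y hy using fun i ↦ hx ⟨i, rfl⟩
  obtain rfl : (fun i ↦ φ (y i)) = x := funext hy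
  have hfy : ∑ i, f i • y i = 0 := hinj (by simpa using hfx)
  obtain ⟨k, a, z, hz, ha⟩ := Module.Flat.isTrivialRelation_of_sum_smul_eq_zero (R := R) (M := B) hfy
  exact ⟨k, a, fun j ↦ φ (z j), fun i ↦ by simp [hz i], ha⟩

lemma IsHenselization.map_maximalIdeal (h : IsHenselization R S) :
    (maximalIdeal R).map (algebraMap R S) = maximalIdeal S := by
  have := h.isLocalHom
  refine le_antisymm (((local_hom_TFAE (algebraMap R S)).out 0 2).1 this) fun x hx ↦ ?_
  obtain ⟨B, _, _, _, _, φ, _, -, hmax, hB⟩ := h.exists_injective_algHom (Set.finite_singleton x)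
  obtain ⟨b, rfl⟩ := hB rfl
  have hb : b ∈ maximalIdeal B := (map_mem_nonunits_iff φ b).1 hx
  rw [← hmax] at hb
  have := Ideal.mem_map_of_mem (φ : B →+* S) hb
  rwa [Ideal.map_map, AlgHom.comp_algebraMap_of_tower] at this

lemma IsHenselization.bijective_quotientMap (h : IsHenselization R S) (n : ℕ)
    (hle : maximalIdeal R ^ n ≤ (maximalIdeal S ^ n).comap (algebraMap R S)) :
    Function.Bijective (Ideal.quotientMap (maximalIdeal S ^ n) (algebraMap R S) hle) := by
  obtain ⟨θ, _⟩ := h.exists_algHom_adicCompletion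
  have hpow : maximalIdeal S ^ n = (maximalIdeal R ^ n).map (algebraMap R S) := by
    rw [Ideal.map_pow, h.map_maximalIdeal]
  constructor
  · refine Ideal.quotientMap_injective' fun r hr ↦ ?_
    rw [Ideal.mem_comap, hpow] at hr
    have h0 := AlgHom.eq_zero_of_mem_map ((AdicCompletion.evalₐ (maximalIdeal R) n).comp θ) hr
    rw [AlgHom.commutes] at h0
    exact Ideal.Quotient.eq_zero_iff_mem.1 h0
  · intro x
    obtain ⟨x, rfl⟩ := Ideal.Quotient.mk_surjective x
    obtain ⟨r, hr⟩ := exists_sub_algebraMap_mem_pow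
      (exists_sub_algebraMap_mem_of_algHom_adicCompletion θ) h.map_maximalIdeal n x
    refine ⟨Ideal.Quotient.mk _ r, ?_⟩
    rw [Ideal.quotientMap_mk, eq_comm, Ideal.Quotient.mk_eq_mk_iff_sub_mem, hpow]
    exact hr

end Henselization
theorem stmt9 (R Rh : Type) [CommRing R] [IsLocalRing R] [IsNoetherianRing R]
    [CommRing Rh] [IsLocalRing Rh] [Algebra R Rh] (h : IsHenselization R Rh) :
    (algebraMap R Rh).Flat ∧ IsLocalHom (algebraMap R Rh) ∧
    ∃ ψ : AdicCompletion (maximalIdeal R) R ≃+* AdicCompletion (maximalIdeal Rh) Rh,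
      ∀ r : R, ψ (algebraMap R (AdicCompletion (maximalIdeal R) R) r) =
        algebraMap Rh (AdicCompletion (maximalIdeal Rh) Rh) (algebraMap R Rh r) := by
  refine ⟨RingHom.flat_algebraMap_iff.2 h.flat, h.isLocalHom, ?_⟩
  have hle (n : ℕ) : maximalIdeal R ^ n ≤ (maximalIdeal Rh ^ n).comap (algebraMap R Rh) := by
    rw [← Ideal.map_le_iff_le_comap, Ideal.map_pow, h.map_maximalIdeal]
  exact AdicCompletion.exists_ringEquiv_of_bijective_quotientMap _ _ hle fun n ↦
    h.bijective_quotientMap n (hle n)
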